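/- Let 0 ≤ λ < 2 and let g ∈ C[0,1] be such that g' is locally absolutely continuous on (0,1) and ‖φ^{2λ} g''‖ < ∞. Then for all ξ ∈ (0,1) and t ∈ [0,1]: |g(t) − g(ξ) − (t−ξ) g'(ξ)| ≤ (4/(2−λ)) · ((t−ξ)² / φ^{2λ}(ξ)) · ‖φ^{2λ} g''‖. -/

import Mathlib

noncomputable section

open Set Finset
open scoped Classical

/-- The interval `[0,1]`. -/
def I01 : Set ℝ := Set.Icc 0 1

/-- `φ(x) = √(x(1-x))`. -/
def phi (x : ℝ) : ℝ := Real.sqrt (x * (1 - x))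

/-- The `k`-th symmetric difference of `f` with step `δ`. -/
def centralDiff (k : ℕ) (δ : ℝ) (f : ℝ → ℝ) (x : ℝ) : ℝ :=
  if (x - k * δ / 2) ∈ I01 ∧ (x + k * δ / 2) ∈ I01 then
    ∑ i ∈ Finset.range (k + 1),
      (k.choose i : ℝ) * (-1 : ℝ) ^ (k - i) * f (x - k * δ / 2 + i * δ)
  else 0

/-- The second Ditzian–Totik modulus of smoothness with step-weight `ψ`. -/
def omega2 (ψ : ℝ → ℝ) (f : ℝ → ℝ) (t : ℝ) : ℝ :=
  sSup {v : ℝ | ∃ s x : ℝ, 0 < s ∧ s ≤ t ∧ x ∈ I01 ∧ v = |centralDiff 2 (s * ψ x) f x|}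

/-- `f` is `k`-monotone on `[0,1]`. -/
def kMono (k : ℕ) (f : ℝ → ℝ) : Prop :=
  ∀ δ : ℝ, 0 < δ → ∀ x ∈ I01, 0 ≤ centralDiff k δ f x

/-- `g` coincides (on all of `ℝ`) with an algebraic polynomial of degree at most `n`. -/
def IsPolyOfDegLe (n : ℕ) (g : ℝ → ℝ) : Prop :=
  ∃ p : Polynomial ℝ, p.natDegree ≤ n ∧ ∀ x, g x = p.eval x

/-- `L` is a positive linear operator `C[0,1] → C[0,1]`. -/
def PositiveLinearOp (L : (ℝ → ℝ) → (ℝ → ℝ)) : Prop :=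
  (∀ f g : ℝ → ℝ, ContinuousOn f I01 → ContinuousOn g I01 →
      ∀ x ∈ I01, L (fun y => f y + g y) x = L f x + L g x) ∧
  (∀ (a : ℝ) (f : ℝ → ℝ), ContinuousOn f I01 →
      ∀ x ∈ I01, L (fun y => a * f y) x = a * L f x) ∧
  (∀ f : ℝ → ℝ, ContinuousOn f I01 → ContinuousOn (L f) I01) ∧
  (∀ f : ℝ → ℝ, ContinuousOn f I01 → (∀ x ∈ I01, 0 ≤ f x) → ∀ x ∈ I01, 0 ≤ L f x)

open MeasureTheory

/-- `g` is locally absolutely continuous on `(0,1)`: on every compact subinterval it is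
the integral of an integrable function. -/
def LocAC (g : ℝ → ℝ) : Prop :=
  ∀ a b : ℝ, 0 < a → a ≤ b → b < 1 →
    ∃ h : ℝ → ℝ, MeasureTheory.IntegrableOn h (Set.Icc a b) ∧
      ∀ x ∈ Set.Icc a b, g x = g a + ∫ t in a..x, h t

/-- The essential supremum of `|w · g''|` over `(0,1)` (with value in `ℝ≥0∞`). -/
def wNormE (w g : ℝ → ℝ) : ENNReal :=
  essSup (fun x => (‖w x * deriv (deriv g) x‖₊ : ENNReal))
    (MeasureTheory.volume.restrict (Set.Ioo (0 : ℝ) 1))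

lemma phi_rpow_two_mul {x : ℝ} (hx : x ∈ Set.Icc (0 : ℝ) 1) (lam : ℝ) :
    phi x ^ (2 * lam) = (x * (1 - x)) ^ lam := by
  have h : 0 ≤ x * (1 - x) := mul_nonneg hx.1 (sub_nonneg.2 hx.2)
  rw [phi, Real.sqrt_eq_rpow, ← Real.rpow_mul h]
  congr 1
  ring

/-- The ratio `|t - s| / (s (1 - s))` decreases as `s` moves from `ξ` towards `t`. -/
lemma abs_sub_div_mul_one_sub_le {ξ t s : ℝ} (hξ : ξ ∈ Set.Ioo (0 : ℝ) 1)
    (ht : t ∈ Set.Ioo (0 : ℝ) 1) (hs : s ∈ Set.uIcc ξ t) :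
    |t - s| / (s * (1 - s)) ≤ |t - ξ| / (ξ * (1 - ξ)) := by
  obtain ⟨hξ0, hξ1⟩ := hξ
  obtain ⟨ht0, ht1⟩ := ht
  rcases le_total ξ t with h | h
  · rw [Set.uIcc_of_le h] at hs
    obtain ⟨h1, h2⟩ := hs
    have hs0 : 0 < s := by linarith
    have hs1 : 0 < 1 - s := by linarith
    rw [abs_of_nonneg (by linarith), abs_of_nonneg (by linarith),
      div_le_div_iff₀ (by positivity) (mul_pos hξ0 (by linarith))]
    have e : (t - s) * (1 - ξ) ≤ (t - ξ) * (1 - s) := by nlinarith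
    calc (t - s) * (ξ * (1 - ξ)) = (t - s) * (1 - ξ) * ξ := by ring
      _ ≤ (t - ξ) * (1 - s) * s := by
        apply mul_le_mul e h1 hξ0.le
        exact mul_nonneg (by linarith) hs1.le
      _ = _ := by ring
  · rw [Set.uIcc_of_ge h] at hs
    obtain ⟨h1, h2⟩ := hs
    have hs0 : 0 < s := by linarith
    have hs1 : 0 < 1 - s := by linarith
    rw [abs_of_nonpos (by linarith), abs_of_nonpos (by linarith),
      div_le_div_iff₀ (by positivity) (mul_pos hξ0 (by linarith))]
    have e : (s - t) * ξ ≤ (ξ - t) * s := by nlinarith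
    calc -(t - s) * (ξ * (1 - ξ)) = (s - t) * ξ * (1 - ξ) := by ring
      _ ≤ (ξ - t) * s * (1 - s) := by
        apply mul_le_mul e (by linarith) (by linarith)
        exact mul_nonneg (by linarith) hs0.le
      _ = _ := by ring

lemma intervalIntegrable_abs_rpow {p : ℝ} (hp : -1 < p) (d : ℝ) :
    IntervalIntegrable (fun u : ℝ => |u| ^ p) volume 0 d := by
  have key : ∀ d : ℝ, 0 ≤ d → IntervalIntegrable (fun u : ℝ => |u| ^ p) volume 0 d := by
    intro d hd
    refine (intervalIntegral.intervalIntegrable_rpow' hp (a := 0) (b := d)).congr ?_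
    intro u hu
    rw [Set.uIoc_of_le hd] at hu
    simp only [abs_of_pos hu.1]
  rcases le_total 0 d with hd | hd
  · exact key d hd
  · rw [IntervalIntegrable.iff_comp_neg]
    simpa using key (-d) (by linarith)

lemma abs_integral_abs_rpow {p : ℝ} (hp : -1 < p) (d : ℝ) :
    |∫ u in (0 : ℝ)..d, |u| ^ p| = |d| ^ (p + 1) / (p + 1) := by
  have key : ∀ d : ℝ, 0 ≤ d → |∫ u in (0 : ℝ)..d, |u| ^ p| = |d| ^ (p + 1) / (p + 1) := by
    intro d hd
    have : ∫ u in (0 : ℝ)..d, |u| ^ p = ∫ u in (0 : ℝ)..d, u ^ p := by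
      apply intervalIntegral.integral_congr
      intro u hu
      rw [Set.uIcc_of_le hd] at hu
      simp only [abs_of_nonneg hu.1]
    rw [this, integral_rpow (Or.inl hp), Real.zero_rpow (by linarith), sub_zero, abs_of_nonneg hd,
      abs_of_nonneg (div_nonneg (Real.rpow_nonneg hd _) (by linarith))]
  rcases le_total 0 d with hd | hd
  · exact key d hd
  · have h := key (-d) (by linarith)
    rw [abs_neg] at h
    rw [← h, ← neg_zero, ← intervalIntegral.integral_comp_neg (fun u : ℝ => |u| ^ p),
      intervalIntegral.integral_symm]
    simp

lemma LocAC.absolutelyContinuousOnInterval {f : ℝ → ℝ} (hf : LocAC f) {a b : ℝ}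
    (ha : a ∈ Set.Ioo (0 : ℝ) 1) (hb : b ∈ Set.Ioo (0 : ℝ) 1) :
    AbsolutelyContinuousOnInterval f a b := by
  have key : ∀ {a b : ℝ}, 0 < a → a ≤ b → b < 1 → AbsolutelyContinuousOnInterval f a b := by
    intro a b ha hab hb
    obtain ⟨h, hint, heq⟩ := hf a b ha hab hb
    have h1 : IntervalIntegrable h volume a b :=
      (intervalIntegrable_iff_integrableOn_Icc_of_le hab).2 hint
    have h2 := h1.absolutelyContinuousOnInterval_intervalIntegral (c := a) (by simp)
    refine Filter.Tendsto.congr' ?_ h2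
    filter_upwards [Filter.mem_inf_of_right (Filter.mem_principal_self _)] with E hE
    refine Finset.sum_congr rfl fun i hi => ?_
    have hi' := hE.1 i hi
    rw [Set.uIcc_of_le hab] at hi'
    rw [heq _ hi'.1, heq _ hi'.2, dist_add_left]
  rcases le_total a b with h | h
  · exact key ha.1 h hb.2
  · exact (key hb.1 h ha.2).symm

/-- Taylor's formula with integral remainder for a locally absolutely continuous derivative. -/
lemma LocAC.taylor_integral_remainder {g : ℝ → ℝ}
    (hdiff : ∀ x ∈ Set.Ioo (0 : ℝ) 1, DifferentiableAt ℝ g x) (hAC : LocAC (deriv g))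
    {ξ t : ℝ} (hξ : ξ ∈ Set.Ioo (0 : ℝ) 1) (ht : t ∈ Set.Ioo (0 : ℝ) 1) :
    g t - g ξ - (t - ξ) * deriv g ξ = ∫ s in ξ..t, (t - s) * deriv (deriv g) s := by
  have h1 := hAC.absolutelyContinuousOnInterval hξ ht
  have h2 : AbsolutelyContinuousOnInterval (fun s : ℝ => t - s) ξ t :=
    ContDiffOn.absolutelyContinuousOnInterval (by fun_prop)
  have hsub : Set.uIcc ξ t ⊆ Set.Ioo (0 : ℝ) 1 := Set.ordConnected_Ioo.uIcc_subset hξ ht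
  have h3 : ∫ s in ξ..t, deriv g s = g t - g ξ :=
    intervalIntegral.integral_deriv_eq_sub (fun x hx => hdiff x (hsub hx))
      h1.continuousOn.intervalIntegrable
  have h4 : ∀ s : ℝ, deriv (fun s : ℝ => t - s) s = -1 := by
    intro s
    simp
  rw [h2.integral_mul_deriv_eq_deriv_mul h1]
  simp only [h4, neg_one_mul, intervalIntegral.integral_neg, h3]
  ring

lemma ae_abs_le_wNormE {w g : ℝ → ℝ} (hfin : wNormE w g ≠ ⊤) :
    ∀ᵐ x, x ∈ Set.Ioo (0 : ℝ) 1 → |w x * deriv (deriv g) x| ≤ (wNormE w g).toReal := by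
  rw [← ae_restrict_iff' measurableSet_Ioo]
  filter_upwards [ENNReal.ae_le_essSup (μ := volume.restrict (Set.Ioo (0 : ℝ) 1))
    (fun x => (‖w x * deriv (deriv g) x‖₊ : ENNReal))] with x hx
  simpa using ENNReal.toReal_mono hfin hx

/-- The remainder estimate at interior points, with constant `1 / (2 - lam)`. -/
lemma abs_taylor_remainder_le {lam : ℝ} (hlam : lam ∈ Set.Ico (0 : ℝ) 2) {g : ℝ → ℝ}
    (hdiff : ∀ x ∈ Set.Ioo (0 : ℝ) 1, DifferentiableAt ℝ g x) (hAC : LocAC (deriv g))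
    (hfin : wNormE (fun y => phi y ^ (2 * lam)) g ≠ ⊤) {ξ t : ℝ}
    (hξ : ξ ∈ Set.Ioo (0 : ℝ) 1) (ht : t ∈ Set.Ioo (0 : ℝ) 1) :
    |g t - g ξ - (t - ξ) * deriv g ξ| ≤
      1 / (2 - lam) * ((t - ξ) ^ 2 / phi ξ ^ (2 * lam)) *
        (wNormE (fun y => phi y ^ (2 * lam)) g).toReal := by
  obtain ⟨hl0, hl2⟩ := hlam
  set M := (wNormE (fun y => phi y ^ (2 * lam)) g).toReal with hM
  have hM0 : 0 ≤ M := ENNReal.toReal_nonneg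
  have hsub : Set.uIcc ξ t ⊆ Set.Ioo (0 : ℝ) 1 := Set.ordConnected_Ioo.uIcc_subset hξ ht
  have hw : ∀ {x : ℝ}, x ∈ Set.Ioo (0 : ℝ) 1 → 0 < x * (1 - x) :=
    fun hx => mul_pos hx.1 (sub_pos.2 hx.2)
  rw [hAC.taylor_integral_remainder hdiff hξ ht, phi_rpow_two_mul ⟨hξ.1.le, hξ.2.le⟩]
  set K := |t - ξ| ^ lam / (ξ * (1 - ξ)) ^ lam * M with hK
  have hK0 : 0 ≤ K :=
    mul_nonneg (div_nonneg (by positivity) (Real.rpow_nonneg (hw hξ).le _)) hM0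
  have hp : -1 < 1 - lam := by linarith
  have hint : IntervalIntegrable (fun s => |t - s| ^ (1 - lam)) volume ξ t := by
    simpa using ((intervalIntegrable_abs_rpow hp (t - ξ)).comp_sub_left t).symm
  have hbound : ∀ᵐ s ∂volume.restrict (Set.uIoc ξ t),
      ‖(t - s) * deriv (deriv g) s‖ ≤ K * |t - s| ^ (1 - lam) := by
    rw [ae_restrict_iff' measurableSet_uIoc]
    filter_upwards [ae_abs_le_wNormE hfin] with s hs hsm
    have hsu : s ∈ Set.uIcc ξ t := Set.uIoc_subset_uIcc hsm
    have hs01 := hsub hsu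
    have hs' := hs hs01
    rw [phi_rpow_two_mul ⟨hs01.1.le, hs01.2.le⟩, ← hM, abs_mul,
      abs_of_pos (Real.rpow_pos_of_pos (hw hs01) _)] at hs'
    rw [Real.norm_eq_abs, abs_mul]
    rcases eq_or_ne t s with rfl | hne
    · simp only [sub_self, abs_zero, zero_mul]
      positivity
    have hts : 0 < |t - s| := abs_pos.2 (sub_ne_zero.2 hne)
    have hratio : |t - s| ^ lam / (s * (1 - s)) ^ lam ≤ |t - ξ| ^ lam / (ξ * (1 - ξ)) ^ lam := by
      rw [← Real.div_rpow (abs_nonneg _) (hw hs01).le, ← Real.div_rpow (abs_nonneg _) (hw hξ).le]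
      exact Real.rpow_le_rpow (div_nonneg (abs_nonneg _) (hw hs01).le)
        (abs_sub_div_mul_one_sub_le hξ ht hsu) hl0
    have hwpos : 0 < (s * (1 - s)) ^ lam := Real.rpow_pos_of_pos (hw hs01) _
    have hsplit : |t - s| = |t - s| ^ (1 - lam) * |t - s| ^ lam := by
      rw [← Real.rpow_add hts, sub_add_cancel, Real.rpow_one]
    calc |t - s| * |deriv (deriv g) s| ≤ |t - s| * (M / (s * (1 - s)) ^ lam) := by
          gcongr
          rw [le_div_iff₀ hwpos, mul_comm]
          exact hs'
      _ = |t - s| ^ (1 - lam) * |t - s| ^ lam * (M / (s * (1 - s)) ^ lam) := by rw [← hsplit]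
      _ = |t - s| ^ lam / (s * (1 - s)) ^ lam * M * |t - s| ^ (1 - lam) := by ring
      _ ≤ K * |t - s| ^ (1 - lam) := by rw [hK]; gcongr
  have h1 := intervalIntegral.norm_integral_le_abs_of_norm_le hbound (hint.const_mul K)
  rw [intervalIntegral.integral_const_mul, abs_mul, abs_of_nonneg hK0,
    intervalIntegral.integral_comp_sub_left (fun u : ℝ => |u| ^ (1 - lam)), sub_self,
    abs_integral_abs_rpow hp, Real.norm_eq_abs] at h1
  refine h1.trans_eq ?_
  have h2 : |t - ξ| ^ lam * |t - ξ| ^ (1 - lam + 1) = (t - ξ) ^ 2 := by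
    rw [← Real.rpow_add_of_nonneg (abs_nonneg _) hl0 (by linarith), ← sq_abs, ← Real.rpow_natCast]
    congr 1
    push_cast
    ring
  rw [hK, ← h2, show 1 - lam + 1 = 2 - lam by ring]
  ring

theorem statement4 (lam : ℝ) (hlam : lam ∈ Set.Ico (0 : ℝ) 2)
    (g : ℝ → ℝ) (hg : ContinuousOn g I01)
    (hdiff : ∀ x ∈ Set.Ioo (0 : ℝ) 1, DifferentiableAt ℝ g x)
    (hAC : LocAC (deriv g))
    (hfin : wNormE (fun y => phi y ^ (2 * lam)) g ≠ ⊤)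
    (ξ : ℝ) (hξ : ξ ∈ Set.Ioo (0 : ℝ) 1) (t : ℝ) (ht : t ∈ I01) :
    |g t - g ξ - (t - ξ) * deriv g ξ| ≤
      4 / (2 - lam) * ((t - ξ) ^ 2 / phi ξ ^ (2 * lam)) *
        (wNormE (fun y => phi y ^ (2 * lam)) g).toReal := by
  have hcl : t ∈ closure (Set.Ioo (0 : ℝ) 1) := by
    rw [closure_Ioo zero_ne_one]
    exact ht
  have hg' : ContinuousOn g (closure (Set.Ioo (0 : ℝ) 1)) := by
    rw [closure_Ioo zero_ne_one]
    exact hg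
  have h1 : |g t - g ξ - (t - ξ) * deriv g ξ| ≤
      1 / (2 - lam) * ((t - ξ) ^ 2 / phi ξ ^ (2 * lam)) *
        (wNormE (fun y => phi y ^ (2 * lam)) g).toReal :=
    le_on_closure (fun x hx => abs_taylor_remainder_le hlam hdiff hAC hfin hξ hx)
      (by fun_prop) (by fun_prop) hcl
  refine h1.trans ?_
  have h2 : 0 < 2 - lam := sub_pos.2 hlam.2
  have h3 : 0 ≤ phi ξ := Real.sqrt_nonneg _
  gcongr
  norm_num
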